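/- arXiv:1303.3718 — 5 statements merged into one kernel-verified Lean document; each statement's English description precedes it below -/
import Mathlib

section
/- Let M be a monoid with a right action on a set X. The action category X//M is equivalent to a totally disconnected category if and only if for every x ∈ X and every m ∈ M there exists a unit k of M such that x·m = x·k. -/
open CategoryTheory

/-- A right action of a monoid `M` on a type `X`. -/
class RightAction (M X : Type) [Monoid M] where
  act : X → M → X
  act_one : ∀ x : X, act x 1 = x
  act_mul : ∀ (x : X) (m k : M), act (act x m) k = act x (m * k)

/-- The action category `X // M` of a right action of a monoid `M` on `X`:
objects are the elements of `X`, and a morphism `x ⟶ y` is an element `m : M`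
with `y = x · m`. -/
structure ActionCat (M X : Type) [Monoid M] [RightAction M X] where
  obj : X

instance (M X : Type) [Monoid M] [RightAction M X] : Category (ActionCat M X) where
  Hom a b := { m : M // RightAction.act a.obj m = b.obj }
  id a := ⟨1, RightAction.act_one a.obj⟩
  comp f g := ⟨f.1 * g.1, by rw [← RightAction.act_mul, f.2, g.2]⟩
  id_comp f := Subtype.ext (one_mul _)
  comp_id f := Subtype.ext (mul_one _)
  assoc f g h := Subtype.ext (mul_assoc _ _ _)


/-- If a category is equivalent to a totally disconnected one, then objects joined by a morphism
are isomorphic. -/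
theorem CategoryTheory.Equivalence.nonempty_iso_of_hom {C D : Type*} [Category C] [Category D]
    (e : C ≌ D) (h : ∀ a b : D, (a ⟶ b) → a = b) {x y : C} (f : x ⟶ y) : Nonempty (x ≅ y) :=
  ⟨e.functor.preimageIso (eqToIso (h _ _ (e.functor.map f)))⟩

/-- If objects joined by a morphism are isomorphic, then the skeleton is totally disconnected. -/
theorem CategoryTheory.Skeleton.eq_of_hom {C : Type*} [Category C]
    (h : ∀ x y : C, (x ⟶ y) → Nonempty (x ≅ y)) (a b : Skeleton C) (f : a ⟶ b) : a = b := by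
  obtain ⟨i⟩ := h _ _ ((fromSkeleton C).map f)
  exact skeleton_skeletal C ⟨(fromSkeleton C).preimageIso i⟩

/-- Two objects of an action category are isomorphic if and only if a unit carries one to the
other. -/
theorem ActionCat.nonempty_iso_iff {M X : Type} [Monoid M] [RightAction M X]
    (x y : ActionCat M X) :
    Nonempty (x ≅ y) ↔ ∃ k : M, IsUnit k ∧ RightAction.act x.obj k = y.obj := by
  constructor
  · rintro ⟨i⟩
    exact ⟨i.hom.1, ⟨⟨i.hom.1, i.inv.1, congrArg Subtype.val i.hom_inv_id,
      congrArg Subtype.val i.inv_hom_id⟩, rfl⟩, i.hom.2⟩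
  · rintro ⟨_, ⟨u, rfl⟩, hu⟩
    have hinv : RightAction.act y.obj (↑u⁻¹ : M) = x.obj := by
      rw [← hu, RightAction.act_mul, u.mul_inv, RightAction.act_one]
    exact ⟨⟨⟨u, hu⟩, ⟨_, hinv⟩, Subtype.ext u.mul_inv, Subtype.ext u.inv_mul⟩⟩

/-- The action category `X // M` is equivalent to a totally disconnected category
(one in which every morphism has equal source and target) if and only if for every
`x ∈ X` and every `m ∈ M` there exists a unit `k` of `M` with `x·m = x·k`. -/
theorem actionCat_equiv_totallyDisconnected_iff (M X : Type) [Monoid M] [RightAction M X] :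
    (∃ (D : Type) (_ : SmallCategory D),
        (∀ (a b : D), (a ⟶ b) → a = b) ∧ Nonempty (ActionCat M X ≌ D)) ↔
      ∀ (x : X) (m : M), ∃ k : M, IsUnit k ∧
        RightAction.act x m = RightAction.act x k := by
  constructor
  · rintro ⟨D, _, hD, ⟨e⟩⟩ x m
    let f : (⟨x⟩ : ActionCat M X) ⟶ ⟨RightAction.act x m⟩ := ⟨m, rfl⟩
    obtain ⟨k, hk, hxk⟩ := (ActionCat.nonempty_iso_iff _ _).1 (e.nonempty_iso_of_hom hD f)
    exact ⟨k, hk, hxk.symm⟩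
  · intro h
    refine ⟨Skeleton (ActionCat M X), inferInstance, Skeleton.eq_of_hom fun x y f ↦ ?_,
      ⟨(skeletonEquivalence _).symm⟩⟩
    obtain ⟨k, hk, hxk⟩ := h x.obj f.1
    exact (ActionCat.nonempty_iso_iff x y).2 ⟨k, hk, hxk.symm.trans f.2⟩
end

section
/- A small category C is equivalent to a totally disconnected category if and only if any two objects of C that are connected by a zigzag of morphisms (i.e., lie in the same connected component) are isomorphic in C. -/
open CategoryTheory

/-- A small category `C` is equivalent to a totally disconnected category (one in which
every morphism has equal source and target, i.e. each connected component has exactly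
one object) if and only if any two objects of `C` lying in the same connected component
(i.e. related by a zigzag of morphisms) are isomorphic in `C`. -/
theorem equiv_totallyDisconnected_iff_zigzag_implies_iso (C : Type) [SmallCategory C] :
    (∃ (D : Type) (_ : SmallCategory D),
        (∀ (a b : D), (a ⟶ b) → a = b) ∧ Nonempty (C ≌ D)) ↔
      ∀ x y : C, Zigzag x y → Nonempty (x ≅ y) := by
  constructor
  · rintro ⟨D, _, hD, ⟨e⟩⟩ x y h
    have obj_eq : e.functor.obj x = e.functor.obj y := by
      induction h with
      | refl => rfl
      | tail _ hyz ih =>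
        obtain ⟨⟨f⟩⟩ | ⟨⟨f⟩⟩ := hyz
        · exact ih.trans (hD _ _ (e.functor.map f))
        · exact ih.trans (hD _ _ (e.functor.map f)).symm
    exact ⟨e.functor.preimageIso (eqToIso obj_eq)⟩
  · intro h
    refine ⟨Skeleton C, inferInstance, fun a b f => ?_, ⟨(skeletonEquivalence C).symm⟩⟩
    obtain ⟨i⟩ := h _ _ (Zigzag.of_hom ((fromSkeleton C).map f))
    exact skeleton_skeletal C ⟨(fromSkeleton C).preimageIso i⟩
end

section
/- Let C be a small category, x an object of C, and suppose given for every object y ≠ x an isomorphism c_y : x ≅ y in C. Then for every category D, every object d₀ of D, every monoid homomorphism α from the endomorphism monoid End_C(x) to End_D(d₀), and every family consisting of an object d_y of D and an isomorphism e_y : d₀ ≅ d_y for each y ≠ x, there exists a unique functor γ : C ⥤ D such that γ(x) = d₀, γ(y) = d_y for all y ≠ x, γ(f) = α(f) for every endomorphism f of x, and γ(c_y) = e_y for all y ≠ x. -/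
open CategoryTheory

namespace CategoryTheory

universe v₁ v₂ u₁ u₂

variable {C : Type u₁} [Category.{v₁} C] {D : Type u₂} [Category.{v₂} D]

/-- The functor determined by a homomorphism on the endomorphisms of a basepoint `x`, and by
isomorphisms from the basepoint to every object, on both sides. -/
@[simps]
def Functor.ofEndOfIso {x : C} (c : ∀ y : C, x ≅ y) {d₀ : D} (α : End x →* End d₀)
    {d : C → D} (e : ∀ y : C, d₀ ≅ d y) : C ⥤ D where
  obj := d
  map {y z} f := (e y).inv ≫ (show d₀ ⟶ d₀ from α ((c y).hom ≫ f ≫ (c z).inv)) ≫ (e z).hom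
  map_id y := by
    have h : α (𝟙 x) = 𝟙 d₀ := α.map_one
    simp [h]
  map_comp {y z w} f g := by
    have h := α.map_mul ((c z).hom ≫ g ≫ (c w).inv) ((c y).hom ≫ f ≫ (c z).inv)
    simp only [End.mul_def, Category.assoc, Iso.inv_hom_id_assoc] at h
    simp only [Category.assoc, Iso.hom_inv_id_assoc]
    rw [h]
    simp

/-- Two functors agree if they agree on objects, on the endomorphisms of a basepoint, and on
isomorphisms from the basepoint to every other object. -/
theorem Functor.ext_of_end_of_iso {x : C} (c : ∀ y : C, y ≠ x → (x ≅ y)) {F G : C ⥤ D}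
    (hobj : ∀ y, F.obj y = G.obj y)
    (hend : ∀ f : x ⟶ x, F.map f ≍ G.map f)
    (hiso : ∀ (y : C) (h : y ≠ x), F.map (c y h).hom ≍ G.map (c y h).hom) : F = G := by
  have key : ∀ y, ∃ i : x ≅ y, F.map i.hom ≍ G.map i.hom := fun y => by
    by_cases h : y = x
    · subst h
      exact ⟨Iso.refl _, hend _⟩
    · exact ⟨c y h, hiso y h⟩
  choose i hi using key
  refine Functor.ext hobj fun y z f => ?_
  have conj {a b : C} {g : a ⟶ b} (h : F.map g ≍ G.map g) :
      F.map g = eqToHom (hobj a) ≫ G.map g ≫ eqToHom (hobj b).symm :=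
    (conj_eqToHom_iff_heq _ _ (hobj a) (hobj b)).2 h
  have hloop := conj (hend ((i y).hom ≫ f ≫ (i z).inv))
  rw [← cancel_epi (F.map (i y).hom), ← cancel_mono (F.map (i z).inv)]
  have hz : F.map (i z).inv = eqToHom (hobj z) ≫ G.map (i z).inv ≫ eqToHom (hobj x).symm := by
    rw [← cancel_epi (F.map (i z).hom), ← F.map_comp, conj (hi z)]
    simp
  simpa [conj (hi y), hz] using hloop

end CategoryTheory

/-- Universal property underlying the wedge decomposition of a category all of whose
objects are isomorphic.  Let `C` be a small category, `x` an object of `C`, and suppose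
given for every object `y ≠ x` an isomorphism `c y : x ≅ y`.  Then for every category
`D`, every object `d₀` of `D`, every monoid homomorphism `α : End x →* End d₀`, and
every family of objects `d y` with isomorphisms `e y : d₀ ≅ d y` for `y ≠ x`, there is
a unique functor `γ : C ⥤ D` with `γ x = d₀`, `γ y = d y`, `γ f = α f` on endomorphisms
of `x`, and `γ (c y) = e y`. -/
theorem exists_unique_functor_of_wedge_data {C : Type} [SmallCategory C] (x : C)
    (c : ∀ y : C, y ≠ x → (x ≅ y))
    {D : Type*} [Category D] (d₀ : D)
    (α : CategoryTheory.End x →* CategoryTheory.End d₀)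
    (d : ∀ y : C, y ≠ x → D)
    (e : ∀ (y : C) (h : y ≠ x), d₀ ≅ d y h) :
    ∃! γ : C ⥤ D,
      γ.obj x = d₀ ∧
      (∀ (y : C) (h : y ≠ x), γ.obj y = d y h) ∧
      (∀ f : x ⟶ x, HEq (γ.map f) (α f)) ∧
      (∀ (y : C) (h : y ≠ x), HEq (γ.map (c y h).hom) (e y h).hom) := by
  classical
  have key : ∀ y : C, ∃ (i : x ≅ y) (d' : D) (j : d₀ ≅ d'),
      (y = x → i.hom ≍ 𝟙 x ∧ ∃ hd : d₀ = d', j = eqToIso hd) ∧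
      ∀ h : y ≠ x, i = c y h ∧ d' = d y h ∧ j.hom ≍ (e y h).hom := fun y => by
    by_cases h : y = x
    · subst h
      exact ⟨Iso.refl _, d₀, Iso.refl _, fun _ => ⟨.rfl, rfl, rfl⟩, fun h => absurd rfl h⟩
    · exact ⟨c y h, d y h, e y h, fun h' => absurd h' h, fun _ => ⟨rfl, rfl, .rfl⟩⟩
  choose i d' j hbase hother using key
  obtain ⟨hix, hdx, hjx⟩ := hbase x rfl
  replace hix : i x = Iso.refl x := Iso.ext (eq_of_heq hix)
  have hend : ∀ f : x ⟶ x, (Functor.ofEndOfIso i α j).map f ≍ α f := fun f => by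
    simp only [Functor.ofEndOfIso_map, hix, hjx, Iso.refl_hom, Iso.refl_inv, Category.id_comp,
      Category.comp_id, eqToIso.hom, eqToIso.inv]
    exact (eqToHom_comp_heq _ _).trans (comp_eqToHom_heq _ _)
  have hiso : ∀ (y : C) (h : y ≠ x),
      (Functor.ofEndOfIso i α j).map (c y h).hom ≍ (e y h).hom := fun y h => by
    obtain ⟨hi, -, hj⟩ := hother y h
    have hα : α (𝟙 x) = 𝟙 d₀ := α.map_one
    simp only [Functor.ofEndOfIso_map, hix, hi, hjx, Iso.refl_hom, Category.id_comp,
      Iso.hom_inv_id, hα, eqToIso.inv]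
    exact (eqToHom_comp_heq _ _).trans hj
  refine ⟨Functor.ofEndOfIso i α j, ⟨hdx.symm, fun y h => (hother y h).2.1, hend, hiso⟩, ?_⟩
  rintro γ ⟨hx, hy, hend', hiso'⟩
  refine Functor.ext_of_end_of_iso c (fun y => ?_)
    (fun f => (hend' f).trans (hend f).symm) (fun y h => (hiso' y h).trans (hiso y h).symm)
  by_cases h : y = x
  · subst h
    exact hx.trans hdx
  · exact (hy y h).trans (hother y h).2.1.symm
end

section
/- Let C be a small category and M a monoid, viewed as a one-object category SingleObj M. For every functor ψ : C ⥤ SingleObj M there exists a unique monoid homomorphism φ : U(C) → M such that φ(⟦f⟧) = ψ(f) for every morphism f of C. (Equivalently, monoid homomorphisms U(C) → M are in natural bijection with functors C ⥤ SingleObj M.) -/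
open CategoryTheory

/-- The set of all morphisms of a small category `C`. -/
abbrev Mor (C : Type) [SmallCategory C] : Type := Σ x y : C, x ⟶ y

/-- The generating relations for the universal monoid `U(C)` on a small category `C`:
the identity `id_x` of each object is related to `1`, and the composite `g ∘ f` of a
composable pair is related to the product of the generators corresponding to `f` and
`g` (multiplication being written in the same order as classical composition, matching
the convention `f ≫ g = g * f` of `CategoryTheory.SingleObj` and `CategoryTheory.End`). -/
def uRel (C : Type) [SmallCategory C] :
    FreeMonoid (Mor C) → FreeMonoid (Mor C) → Prop := fun a b =>
  (∃ x : C, a = FreeMonoid.of ⟨x, x, 𝟙 x⟩ ∧ b = 1) ∨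
  (∃ (x y z : C) (f : x ⟶ y) (g : y ⟶ z),
    a = FreeMonoid.of ⟨x, z, f ≫ g⟩ ∧
    b = FreeMonoid.of ⟨y, z, g⟩ * FreeMonoid.of ⟨x, y, f⟩)

/-- The universal monoid `U(C)` of a small category `C`: the quotient of the free
monoid on the set of all morphisms of `C` by the monoid congruence generated by the
relations `id_x ~ 1` and `(g ∘ f) ~ g·f`. -/
abbrev UMon (C : Type) [SmallCategory C] : Type := (conGen (uRel C)).Quotient

/-- The class `⟦f⟧` in `U(C)` of a morphism `f` of `C`. -/
def UMon.mk {C : Type} [SmallCategory C] {x y : C} (f : x ⟶ y) : UMon C :=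
  (conGen (uRel C)).mk' (FreeMonoid.of ⟨x, y, f⟩)

theorem conGen_uRel_le_ker {C : Type} [SmallCategory C] {M : Type} [Monoid M]
    (ψ : C ⥤ SingleObj M) :
    conGen (uRel C) ≤ Con.ker (FreeMonoid.lift fun m : Mor C => (ψ.map m.2.2 : M)) := by
  refine Con.conGen_le.mpr ?_
  rintro a b (⟨x, rfl, rfl⟩ | ⟨x, y, z, f, g, rfl, rfl⟩)
  · rw [Con.ker_rel, FreeMonoid.lift_eval_of, map_one]
    exact ψ.map_id x
  · rw [Con.ker_rel, map_mul]
    simp only [FreeMonoid.lift_eval_of]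
    exact ψ.map_comp f g

theorem UMon.hom_ext {C : Type} [SmallCategory C] {M : Type} [Monoid M] {φ φ' : UMon C →* M}
    (h : ∀ (x y : C) (f : x ⟶ y), φ (UMon.mk f) = φ' (UMon.mk f)) : φ = φ' :=
  Con.hom_ext (FreeMonoid.hom_eq fun ⟨x, y, f⟩ => h x y f)

/-- Universal property of the universal monoid `U(C)`: for every functor
`ψ : C ⥤ SingleObj M` to a monoid `M` viewed as a one-object category, there is a
unique monoid homomorphism `φ : U(C) →* M` with `φ ⟦f⟧ = ψ.map f` for every morphism
`f` of `C`. -/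
theorem uMon_universal_property {C : Type} [SmallCategory C] (M : Type) [Monoid M]
    (ψ : C ⥤ SingleObj M) :
    ∃! φ : UMon C →* M, ∀ (x y : C) (f : x ⟶ y), φ (UMon.mk f) = ψ.map f := by
  refine ⟨Con.lift _ _ (conGen_uRel_le_ker ψ), fun x y f => ?_, fun φ hφ => ?_⟩
  · exact FreeMonoid.lift_eval_of _ _
  · exact UMon.hom_ext fun x y f => (hφ x y f).trans (FreeMonoid.lift_eval_of _ _).symm
end

section
/- Let C be a pointed category and M a monoid, viewed as a one-object category SingleObj M. For every functor ψ : C ⥤ SingleObj M that sends every endomorphism of the basepoint pt to the identity element 1 of M, there exists a unique monoid homomorphism φ : U[C] → M such that φ(⟦f⟧) = ψ(f) for every morphism f of C. -/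
open CategoryTheory

/-- The generating relations for the reduced universal monoid `U[C]` of a pointed
category `(C, pt)`: in addition to the relations of `U(C)`, every endomorphism of the
basepoint `pt` is related to `1`. -/
def uRedRel (C : Type) [SmallCategory C] (pt : C) :
    FreeMonoid (Mor C) → FreeMonoid (Mor C) → Prop := fun a b =>
  uRel C a b ∨ (∃ e : pt ⟶ pt, a = FreeMonoid.of ⟨pt, pt, e⟩ ∧ b = 1)

/-- The reduced universal monoid `U[C]` of a pointed category `(C, pt)`: the quotient
of the free monoid on the morphisms of `C` by the monoid congruence generated by the
relations `id_x ~ 1`, `(g ∘ f) ~ g·f`, and `e ~ 1` for every endomorphism `e` of `pt`. -/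
abbrev URed (C : Type) [SmallCategory C] (pt : C) : Type := (conGen (uRedRel C pt)).Quotient

/-- The class `⟦f⟧` in `U[C]` of a morphism `f` of `C`. -/
def URed.mk {C : Type} [SmallCategory C] (pt : C) {x y : C} (f : x ⟶ y) : URed C pt :=
  (conGen (uRedRel C pt)).mk' (FreeMonoid.of ⟨x, y, f⟩)

/-- Universal property of the reduced universal monoid `U[C]` of a pointed category
`(C, pt)`: every functor `ψ : C ⥤ SingleObj M` sending all endomorphisms of the
basepoint to `1` factors uniquely through a monoid homomorphism `φ : U[C] →* M` with
`φ ⟦f⟧ = ψ.map f` for every morphism `f` of `C`. -/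
theorem uRed_universal_property {C : Type} [SmallCategory C] (pt : C)
    (M : Type) [Monoid M] (ψ : C ⥤ SingleObj M)
    (hψ : ∀ e : pt ⟶ pt, ψ.map e = 1) :
    ∃! φ : URed C pt →* M, ∀ (x y : C) (f : x ⟶ y), φ (URed.mk pt f) = ψ.map f := by
  let lift : FreeMonoid (Mor C) →* M := FreeMonoid.lift fun m => ψ.map m.2.2
  have lift_of {x y : C} (f : x ⟶ y) : lift (FreeMonoid.of ⟨x, y, f⟩) = ψ.map f :=
    FreeMonoid.lift_eval_of _ _
  have le_ker : conGen (uRedRel C pt) ≤ Con.ker lift := by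
    refine Con.conGen_le.2 ?_
    rintro _ _ ((⟨x, rfl, rfl⟩ | ⟨x, y, z, f, g, rfl, rfl⟩) | ⟨e, rfl, rfl⟩) <;>
      rw [Con.ker_rel]
    · exact (lift_of _).trans ((ψ.map_id x).trans (map_one lift).symm)
    · rw [map_mul, lift_of, lift_of, lift_of]
      exact ψ.map_comp f g
    · exact (lift_of e).trans ((hψ e).trans (map_one lift).symm)
  refine ⟨Con.lift _ lift le_ker, fun x y f => lift_of f, fun φ hφ => ?_⟩
  refine Con.hom_ext (FreeMonoid.hom_eq ?_)
  rintro ⟨x, y, f⟩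
  exact (hφ x y f).trans (lift_of f).symm
end
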